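/- For every K ∈ ℕ, every m ∈ ℕ∪{0}, every constant 0 < c < 1/2 and every ε > 0 there exists D₀ such that the following holds. Let G ∈ H(K) be a finite graph with δ(G) ≥ D₀, let x ∈ V(G), let p := 1/2 − c·√(log d(x)/d(x)), and let A₀ be a p-random subset of V(G). Then, for the process A_i(m), Pr[x ∈ A₂(m)] ≥ 3/4 − ε. -/

import Mathlib

open SimpleGraph Filter

namespace MBP

/-- Degree of a vertex, via the cardinality of its neighbourhood. -/
noncomputable def deg {V : Type} (G : SimpleGraph V) (x : V) : ℕ :=
  (G.neighborSet x).ncard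

/-- Minimum degree. -/
noncomputable def minDeg {V : Type} (G : SimpleGraph V) : ℕ :=
  sInf (Set.range (deg G))

/-- Maximum degree. -/
noncomputable def maxDeg {V : Type} (G : SimpleGraph V) : ℕ :=
  sSup (Set.range (deg G))

/-- Ball of radius `ℓ` around `x`. -/
def ball {V : Type} (G : SimpleGraph V) (x : V) (ℓ : ℕ) : Set V :=
  {y | G.edist x y ≤ ℓ}

/-- Sphere of radius `ℓ` around `x` (for `ℓ ≥ 1` this is `B(x,ℓ) \ B(x,ℓ-1)`). -/
def sphere {V : Type} (G : SimpleGraph V) (x : V) (ℓ : ℕ) : Set V :=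
  {y | G.edist x y = ℓ}

/-- (P1) locally K-almost regular. -/
def P1 (K : ℕ) {V : Type} (G : SimpleGraph V) : Prop :=
  ∀ (x : V) (ℓ : ℕ), 1 ≤ ℓ → ∀ y ∈ sphere G x ℓ,
    |(deg G x : ℤ) - (deg G y : ℤ)| ≤ (K : ℤ) * ℓ

/-- (P2) K-bounded backwards expansion. -/
def P2 (K : ℕ) {V : Type} (G : SimpleGraph V) : Prop :=
  ∀ (x : V) (ℓ : ℕ), 1 ≤ ℓ → ∀ y ∈ sphere G x ℓ,
    (G.neighborSet y ∩ ball G x ℓ).ncard ≤ K * ℓ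

/-- `D` witnesses property (P3) (typical local structure and K-separation) at vertex `x`. -/
def P3At (K : ℕ) {V : Type} (G : SimpleGraph V) (x : V) (D : Set V) : Prop :=
  x ∉ D ∧ ∀ (ℓ : ℕ), 1 ≤ ℓ →
    ((D ∩ sphere G x ℓ).ncard ≤ K ^ (ℓ - 1) * (deg G x) ^ (ℓ - 1)) ∧
    (∀ y ∈ sphere G x ℓ \ D, (D ∩ G.neighborSet y).ncard ≤ K * ℓ) ∧
    (∀ y ∈ sphere G x ℓ \ D, ∀ z ∈ sphere G x ℓ \ D, y ≠ z →
      (G.neighborSet y ∩ G.neighborSet z ∩ (sphere G x (ℓ + 1) \ D)).ncard ≤ 1) ∧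
    (∀ y ∈ sphere G x ℓ \ D,
      (ball G y (2 * ℓ - 1) ∩ (sphere G x ℓ \ D)).ncard ≤ ℓ * K ^ (ℓ - 1) * (deg G x) ^ (ℓ - 1))

/-- (P3) typical local structure and K-separation. -/
def P3 (K : ℕ) {V : Type} (G : SimpleGraph V) : Prop :=
  ∀ x : V, ∃ D : Set V, P3At K G x D

/-- (P5) exponential order. -/
def P5 (K : ℕ) {V : Type} (G : SimpleGraph V) : Prop :=
  (Nat.card V : ℝ) ≤ Real.exp (K * minDeg G)

/-- (P4) K-projection, relative to a membership predicate `mem` for the projected subgraphs. -/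
def P4With (K : ℕ) {V : Type} (G : SimpleGraph V) (mem : G.Subgraph → Prop) : Prop :=
  ∀ (x : V) (ℓ : ℕ), 1 ≤ ℓ → ∀ y ∈ sphere G x ℓ,
    ∃ H : G.Subgraph, y ∈ H.verts ∧ mem H ∧
      H.verts ∩ ball G x (ℓ - 1) = ∅ ∧
      ∀ w : H.verts, |(deg H.coe w : ℤ) - (deg G (w : V) : ℤ)| ≤ (K : ℤ) * ℓ

/-- Membership in the class H(K) with recursion fuel `n`. -/
def HAux (K : ℕ) : ℕ → (V : Type) → SimpleGraph V → Prop
  | 0, V, _ => Nat.card V = 1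
  | n + 1, V, G =>
      Nat.card V = 1 ∨
        (P1 K G ∧ P2 K G ∧ P3 K G ∧ P4With K G (fun H => HAux K n H.verts H.coe) ∧ P5 K G)

/-- The class `H(K)` of geometric graphs: least class containing the one-vertex graph and
closed under properties (P1)–(P5), where the projections of (P4) again lie in the class. -/
def InH (K : ℕ) {V : Type} (G : SimpleGraph V) : Prop :=
  ∃ n, HAux K n V G

/-- One round of majority bootstrap percolation: a vertex `v` becomes infected if at least
`d(v)/2` of its neighbours are infected. -/
def bootStep {V : Type} (G : SimpleGraph V) (A : Set V) : Set V :=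
  A ∪ {v | (deg G v : ℝ) / 2 ≤ ((G.neighborSet v ∩ A).ncard : ℝ)}

/-- The majority bootstrap percolation process. -/
def bootIter {V : Type} (G : SimpleGraph V) (A0 : Set V) : ℕ → Set V
  | 0 => A0
  | n + 1 => bootStep G (bootIter G A0 n)

/-- `A0` percolates if eventually every vertex is infected. -/
def Percolates {V : Type} (G : SimpleGraph V) (A0 : Set V) : Prop :=
  (⋃ i, bootIter G A0 i) = Set.univ

/-- Weight of a subset `A` under the `p`-random measure. -/
noncomputable def weight {V : Type} (p : ℝ) (A : Set V) : ℝ :=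
  p ^ A.ncard * (1 - p) ^ (Aᶜ).ncard

/-- Probability that a `p`-random subset of `V` satisfies the event `E`. -/
noncomputable def prob {V : Type} (p : ℝ) (E : Set V → Prop) : ℝ :=
  ∑ᶠ A ∈ {A : Set V | E A}, weight p A

/-- Probability that a `p`-random initial set percolates. -/
noncomputable def Phi {V : Type} (p : ℝ) (G : SimpleGraph V) : ℝ :=
  prob p (fun A0 => Percolates G A0)

/-- One round of the `m`-shifted bootstrap process (threshold `d(v)/2 + m`). -/
def bootStepM {V : Type} (G : SimpleGraph V) (m : ℕ) (A : Set V) : Set V :=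
  A ∪ {v | (deg G v : ℝ) / 2 + m ≤ ((G.neighborSet v ∩ A).ncard : ℝ)}

/-- The `m`-shifted bootstrap process. -/
def bootIterM {V : Type} (G : SimpleGraph V) (m : ℕ) (A0 : Set V) : ℕ → Set V
  | 0 => A0
  | n + 1 => bootStepM G m (bootIterM G m A0 n)

/-- `σ(x) = √(log d(x) / d(x))`. -/
noncomputable def sigma' {V : Type} (G : SimpleGraph V) (x : V) : ℝ :=
  Real.sqrt (Real.log (deg G x) / (deg G x))

/-- `γ(x) = √(d(x) / √(log d(x)))`. -/
noncomputable def gamma' {V : Type} (G : SimpleGraph V) (x : V) : ℝ :=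
  Real.sqrt ((deg G x : ℝ) / Real.sqrt (Real.log (deg G x)))

/-- The `Boot₂(γ)` process: in the step from round `ℓ` to round `ℓ+1`, a vertex `v` becomes
infected if at least `d(v)/2 - max(0, 2-ℓ)·γ(v)` of its neighbours are infected. -/
noncomputable def hatIter {V : Type} (G : SimpleGraph V) (A0 : Set V) : ℕ → Set V
  | 0 => A0
  | ℓ + 1 =>
      hatIter G A0 ℓ ∪
        {v | (deg G v : ℝ) / 2 - ((2 - ℓ : ℕ) : ℝ) * gamma' G v
              ≤ ((G.neighborSet v ∩ hatIter G A0 ℓ).ncard : ℝ)}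

/-- Expectation of `f` restricted to the event `E`, under the `p`-random measure. -/
noncomputable def expOn {V : Type} (p : ℝ) (E : Set V → Prop) (f : Set V → ℝ) : ℝ :=
  ∑ᶠ A ∈ {A : Set V | E A}, weight p A * f A

/-- Conditional expectation of `f` given the event `E`. -/
noncomputable def condExp {V : Type} (p : ℝ) (E : Set V → Prop) (f : Set V → ℝ) : ℝ :=
  expOn p E f / prob p E

/-- Conditional variance of `f` given the event `E`. -/
noncomputable def condVar {V : Type} (p : ℝ) (E : Set V → Prop) (f : Set V → ℝ) : ℝ :=
  condExp p E (fun A => (f A - condExp p E f) ^ 2)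

/-- The number of edges between `U` and `W` (ordered pairs `(u,w)` with `u ∈ U`, `w ∈ W`
adjacent; for disjoint sets this is the number of edges with one endpoint in each). -/
noncomputable def eBetween {V : Type} (G : SimpleGraph V) (U W : Set V) : ℕ :=
  {e : V × V | e.1 ∈ U ∧ e.2 ∈ W ∧ G.Adj e.1 e.2}.ncard

/-- Upper tail `Pr[Bin(d,p) ≥ t]` of the binomial distribution. -/
noncomputable def binTail (d : ℕ) (p : ℝ) (t : ℝ) : ℝ :=
  ∑ k ∈ Finset.range (d + 1),
    if t ≤ (k : ℝ) then (d.choose k : ℝ) * p ^ k * (1 - p) ^ (d - k) else 0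




noncomputable def Ex {V : Type} [DecidableEq V] (p : ℝ) (S : Finset V) (f : Finset V → ℝ) : ℝ :=
  ∑ A ∈ S.powerset, p ^ A.card * (1 - p) ^ (S.card - A.card) * f A

theorem Ex_empty {V : Type} [DecidableEq V] (p : ℝ) (f : Finset V → ℝ) : Ex p ∅ f = f ∅ := by
  simp [Ex]

theorem Ex_insert {V : Type} [DecidableEq V] (p : ℝ) (S : Finset V) (a : V) (ha : a ∉ S)
    (f : Finset V → ℝ) :
    Ex p (insert a S) f = (1 - p) * Ex p S f + p * Ex p S (fun A => f (insert a A)) := by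
  unfold Ex
  rw [Finset.sum_powerset_insert ha, Finset.mul_sum, Finset.mul_sum]
  congr 1
  · apply Finset.sum_congr rfl
    intro A hA
    have hA' := Finset.mem_powerset.1 hA
    have := Finset.card_le_card hA'
    rw [Finset.card_insert_of_notMem ha, Nat.succ_sub this, pow_succ]
    ring
  · apply Finset.sum_congr rfl
    intro A hA
    have hA' := Finset.mem_powerset.1 hA
    have := Finset.card_le_card hA'
    rw [Finset.card_insert_of_notMem ha, Finset.card_insert_of_notMem (fun h => ha (hA' h)),
      Nat.add_sub_add_right, pow_succ]
    ring

theorem Ex_add {V : Type} [DecidableEq V] (p : ℝ) (S : Finset V) (f g : Finset V → ℝ) :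
    Ex p S (fun A => f A + g A) = Ex p S f + Ex p S g := by
  simp [Ex, mul_add, Finset.sum_add_distrib]

theorem Ex_smul {V : Type} [DecidableEq V] (p : ℝ) (S : Finset V) (r : ℝ) (g : Finset V → ℝ) :
    Ex p S (fun A => r * g A) = r * Ex p S g := by
  unfold Ex
  rw [Finset.mul_sum]
  exact Finset.sum_congr rfl fun A _ => by ring

theorem Ex_congr {V : Type} [DecidableEq V] (p : ℝ) (S : Finset V) (f g : Finset V → ℝ)
    (h : ∀ A ⊆ S, f A = g A) : Ex p S f = Ex p S g := by
  unfold Ex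
  exact Finset.sum_congr rfl fun A hA => by rw [h A (Finset.mem_powerset.1 hA)]

theorem Ex_mono {V : Type} [DecidableEq V] (p : ℝ) (hp : 0 ≤ p) (hp1 : p ≤ 1) (S : Finset V)
    (f g : Finset V → ℝ)
    (h : ∀ A ⊆ S, f A ≤ g A) : Ex p S f ≤ Ex p S g := by
  unfold Ex
  refine Finset.sum_le_sum fun A hA => ?_
  have := h A (Finset.mem_powerset.1 hA)
  have : 0 ≤ 1 - p := by linarith
  gcongr

theorem Ex_const {V : Type} [DecidableEq V] (p : ℝ) (S : Finset V) (r : ℝ) :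
    Ex p S (fun _ => r) = r := by
  induction S using Finset.induction_on with
  | empty => simp [Ex]
  | insert a S ha ih => rw [Ex_insert p S a ha, ih]; ring

theorem Ex_sum {V ι : Type} [DecidableEq V] (p : ℝ) (S : Finset V) (I : Finset ι)
    (f : ι → Finset V → ℝ) :
    Ex p S (fun A => ∑ i ∈ I, f i A) = ∑ i ∈ I, Ex p S (f i) := by
  unfold Ex
  rw [Finset.sum_comm]
  exact Finset.sum_congr rfl fun A _ => by rw [Finset.mul_sum]

theorem Ex_union {V : Type} [DecidableEq V] (p : ℝ) (U W : Finset V) (h : Disjoint U W)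
    (f : Finset V → ℝ) :
    Ex p (U ∪ W) f = Ex p U (fun B => Ex p W (fun C => f (B ∪ C))) := by
  induction U using Finset.induction_on generalizing f with
  | empty => simp [Ex_empty]
  | insert a U ha ih =>
    rw [Finset.disjoint_insert_left] at h
    rw [Finset.insert_union, Ex_insert _ _ _ (by simp [ha, h.1]), Ex_insert _ _ _ ha,
      ih h.2, ih h.2]
    simp only [Finset.insert_union]

/-- independence on disjoint supports -/
theorem Ex_prod {V : Type} [DecidableEq V] (p : ℝ) (U W : Finset V) (h : Disjoint U W)
    (f g : Finset V → ℝ) (hf : ∀ A, f A = f (A ∩ U)) (hg : ∀ A, g A = g (A ∩ W)) :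
    Ex p (U ∪ W) (fun A => f A * g A) = Ex p U f * Ex p W g := by
  rw [Ex_union p U W h, mul_comm, ← Ex_smul]
  apply Ex_congr
  intro B hB
  rw [mul_comm, ← Ex_smul]
  apply Ex_congr
  intro C hC
  rw [hf (B ∪ C), hg (B ∪ C)]
  have h1 : (B ∪ C) ∩ U = B := by
    rw [Finset.union_inter_distrib_right, Finset.inter_eq_left.2 hB,
      Finset.disjoint_iff_inter_eq_empty.1 (h.symm.mono_left hC), Finset.union_empty]
  have h2 : (B ∪ C) ∩ W = C := by
    rw [Finset.union_inter_distrib_right, Finset.inter_eq_left.2 hC,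
      Finset.disjoint_iff_inter_eq_empty.1 (h.mono_left hB), Finset.empty_union]
  rw [h1, h2]

theorem Ex_restrict {V : Type} [DecidableEq V] (p : ℝ) (S U : Finset V) (h : U ⊆ S)
    (f : Finset V → ℝ) (hf : ∀ A, f A = f (A ∩ U)) :
    Ex p S f = Ex p U f := by
  have := Ex_prod p U (S \ U) Finset.disjoint_sdiff f (fun _ => 1) hf (fun _ => rfl)
  rw [Finset.union_sdiff_of_subset h, Ex_const] at this
  simpa using this

noncomputable def bm (p : ℝ) (n k : ℕ) : ℝ := (n.choose k : ℝ) * (p ^ k * (1 - p) ^ (n - k))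

noncomputable def Bt (p : ℝ) (n T : ℕ) : ℝ :=
  ∑ k ∈ Finset.range (n + 1), bm p n k * (if T ≤ k then 1 else 0)

theorem Ex_card {V : Type} [DecidableEq V] (p : ℝ) (S : Finset V) (g : ℕ → ℝ) :
    Ex p S (fun A => g A.card) = ∑ k ∈ Finset.range (S.card + 1), bm p S.card k * g k := by
  unfold Ex
  rw [Finset.sum_powerset_apply_card (fun k => p ^ k * (1 - p) ^ (S.card - k) * g k)]
  exact Finset.sum_congr rfl fun k _ => by rw [nsmul_eq_mul, bm]; ring

theorem Ex_Bt {V : Type} [DecidableEq V] (p : ℝ) (S : Finset V) (T : ℕ) :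
    Ex p S (fun A => if T ≤ A.card then 1 else 0) = Bt p S.card T :=
  Ex_card p S (fun k => if T ≤ k then 1 else 0)

theorem bm_nonneg {p : ℝ} (h0 : 0 ≤ p) (h1 : p ≤ 1) (n k : ℕ) : 0 ≤ bm p n k := by
  have : 0 ≤ 1 - p := by linarith
  unfold bm; positivity

theorem Bt_nonneg {p : ℝ} (h0 : 0 ≤ p) (h1 : p ≤ 1) (n k : ℕ) : 0 ≤ Bt p n k := by
  refine Finset.sum_nonneg fun i _ => mul_nonneg (bm_nonneg h0 h1 _ _) ?_
  split_ifs <;> simp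

theorem Bt_le_one {p : ℝ} (h0 : 0 ≤ p) (h1 : p ≤ 1) (n k : ℕ) : Bt p n k ≤ 1 := by
  have := Ex_Bt p (Finset.range n) k
  rw [Finset.card_range] at this
  rw [← this]
  refine le_trans (Ex_mono p h0 h1 _ _ (fun _ => 1) fun A _ => ?_) (Ex_const p _ 1).le
  split_ifs <;> norm_num

theorem Bt_step (p : ℝ) (n T : ℕ) : Bt p n T = bm p n T + Bt p n (T + 1) := by
  unfold Bt
  have : ∀ k ∈ Finset.range (n + 1), bm p n k * (if T ≤ k then 1 else 0) =
     (if k = T then bm p n T else 0) + bm p n k * (if T + 1 ≤ k then 1 else 0) := by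
    intro k _
    rcases lt_trichotomy k T with h | h | h
    · simp [h.ne, h.not_ge, (h.trans (Nat.lt_succ_self T)).not_ge]
    · simp [h]
    · simp [h.ne', h.le, Nat.succ_le_of_lt h]
  rw [Finset.sum_congr rfl this, Finset.sum_add_distrib, Finset.sum_ite_eq']
  congr 1
  split_ifs with h
  · rfl
  · simp at h
    simp [bm, Nat.choose_eq_zero_of_lt (show n < T by omega)]

theorem Bt_succ (p : ℝ) (n T : ℕ) :
    Bt p (n + 1) (T + 1) = (1 - p) * Bt p n (T + 1) + p * Bt p n T := by
  have h1 := Ex_Bt p (Finset.range (n+1)) (T+1)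
  have h2 := Ex_Bt p (Finset.range n) (T+1)
  have h3 := Ex_Bt p (Finset.range n) (T)
  rw [Finset.card_range] at h1 h2 h3
  rw [← h1, ← h2, ← h3, Finset.range_add_one, Ex_insert _ _ _ (by simp)]
  congr 2
  apply Ex_congr
  intro A hA
  rw [Finset.card_insert_of_notMem (fun h => by simpa using hA h)]
  simp

theorem Bt_succ_ge {p : ℝ} (h0 : 0 ≤ p) (h1 : p ≤ 1) (n T : ℕ) :
    p * Bt p n T ≤ Bt p (n + 1) (T + 1) := by
  rw [Bt_succ]
  have := Bt_nonneg h0 h1 n (T+1)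
  nlinarith

theorem Bt_shift {p : ℝ} (h0 : 0 ≤ p) (h1 : p ≤ 1) (n T b : ℕ) :
    p ^ b * Bt p n T ≤ Bt p (n + b) (T + b) := by
  induction b with
  | zero => simp
  | succ b ih =>
    have := Bt_succ_ge h0 h1 (n + b) (T + b)
    calc _ = p * (p ^ b * Bt p n T) := by ring
      _ ≤ p * Bt p (n + b) (T + b) := by gcongr
      _ ≤ _ := this

theorem Bt_ge_sum {p : ℝ} (h0 : 0 ≤ p) (h1 : p ≤ 1) (n T M : ℕ) :
    ∑ j ∈ Finset.range M, bm p n (T + j) ≤ Bt p n T := by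
  have : ∑ j ∈ Finset.range M, bm p n (T + j) + Bt p n (T + M) = Bt p n T := by
    induction M with
    | zero => simp
    | succ M ih =>
      rw [Finset.sum_range_succ, ← ih, Bt_step p n (T + M)]; ring_nf
  have := Bt_nonneg h0 h1 n (T + M)
  linarith

theorem bm_ratio (p : ℝ) (n k : ℕ) (h : k < n) :
    bm p n (k + 1) * ((k + 1) * (1 - p)) = bm p n k * ((n - k) * p) := by
  have := Nat.choose_succ_right_eq n k
  have h2 : (n.choose (k+1) : ℝ) * (k + 1) = n.choose k * (n - k) := by
    rw [← Nat.cast_sub h.le]; exact_mod_cast this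
  unfold bm
  obtain ⟨l, rfl⟩ : ∃ l, n = k + 1 + l := ⟨n - (k+1), by omega⟩
  rw [show k + 1 + l - (k + 1) = l by omega, show k + 1 + l - k = l + 1 by omega]
  linear_combination (p ^ (k+1) * (1-p)^(l+1)) * h2

theorem Bt_ge_ratio {p : ℝ} (h0 : 0 < p) (h1 : p ≤ 1 / 2) (h b M : ℕ) (hM : M ≤ h) :
    p * (M * ((((h : ℝ) - M) / (h + b + 1 + M)) * (p / (1 - p))) ^ M)
      * bm p (2 * h + b) (h + b)
      ≤ Bt p (2 * h + (b + 1)) (h + (b + 1)) := by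
  set ρ := (((h : ℝ) - M) / (h + b + 1 + M)) * (p / (1 - p)) with hρ
  have hMh : (M : ℝ) ≤ h := by exact_mod_cast hM
  have hq : 0 < 1 - p := by linarith
  have hρ0 : 0 ≤ ρ := by
    have : 0 ≤ (h : ℝ) - M := by linarith
    positivity
  have hρ1 : ρ ≤ 1 := by
    have a1 : ((h : ℝ) - M) / (h + b + 1 + M) ≤ 1 := by
      rw [div_le_one (by positivity)]; nlinarith [(Nat.cast_nonneg b : (0:ℝ) ≤ b), (Nat.cast_nonneg M : (0:ℝ) ≤ M)]
    have a2 : p / (1 - p) ≤ 1 := by rw [div_le_one hq]; linarith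
    exact mul_le_one₀ a1 (by positivity) a2
  have hr := bm_nonneg h0.le (by linarith : p ≤ 1) (2 * h + b) (h + b)
  have key : ∀ j ≤ M, ρ ^ j * bm p (2 * h + b) (h + b) ≤ bm p (2 * h + b) (h + b + j) := by
    intro j
    induction j with
    | zero => simp
    | succ j ih =>
      intro hj
      have ih := ih (by omega)
      have e := bm_ratio p (2 * h + b) (h + b + j) (by omega)
      push_cast at e
      have hj' : (j : ℝ) + 1 ≤ M := by exact_mod_cast hj
      have nn := bm_nonneg h0.le (by linarith : p ≤ 1) (2 * h + b) (h + b + j)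
      have : ρ * bm p (2 * h + b) (h + b + j) ≤ bm p (2 * h + b) (h + b + (j + 1)) := by
        have e2 : bm p (2 * h + b) (h + b + (j + 1)) =
          ((h - j) / (h + b + j + 1)) * (p / (1 - p)) * bm p (2 * h + b) (h + b + j) := by
          have : (h:ℝ) + b + j + 1 ≠ 0 := by positivity
          field_simp
          rw [← add_assoc]
          linear_combination e
        rw [e2]
        gcongr ?_ * _
        gcongr ?_ * _
        · have : 0 ≤ (h : ℝ) - M := by linarith
          apply div_le_div₀ <;> first | positivity | linarith
      calc _ = ρ * (ρ ^ j * bm p (2 * h + b) (h + b)) := by ring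
        _ ≤ _ := le_trans (by gcongr) this
  refine le_trans ?_ (Bt_succ_ge h0.le (by linarith) (2 * h + b) (h + b))
  rw [mul_assoc]
  gcongr
  refine le_trans ?_ (Bt_ge_sum h0.le (by linarith) _ _ M)
  calc _ = ∑ j ∈ Finset.range M, ρ ^ M * bm p (2 * h + b) (h + b) := by simp; ring
    _ ≤ _ := by
      refine Finset.sum_le_sum fun j hj => ?_
      have hj' := (Finset.mem_range.1 hj).le
      refine le_trans ?_ (key j hj')
      gcongr ?_ * _
      exact pow_le_pow_of_le_one hρ0 hρ1 hj'

theorem Bt_half (p : ℝ) (h0 : 0 < p) (h1 : p ≤ 1 / 2) (h s : ℕ) (hs : 0 < s) (hs2 : 2 * h ≤ s ^ 2) :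
    3 / 8 * ((4 * p * (1 - p)) ^ h * (p / (1 - p)) ^ s) ≤ Bt p (2 * h) h := by
  have hq : 0 < 1 - p := by linarith
  set w : ℕ → ℝ := fun k => bm (1/2) (2 * h) k with hw
  have w0 : ∀ k, 0 ≤ w k := fun k => bm_nonneg (by norm_num) (by norm_num) _ _
  have wsum : ∑ k ∈ Finset.range (2 * h + 1), w k = 1 := by
    have := Ex_card (1/2) (Finset.range (2*h)) (fun _ => 1)
    rw [Ex_const] at this
    simp only [Finset.card_range, mul_one] at this
    exact this.symm
  have wvar : ∑ k ∈ Finset.range (2 * h + 1), ((h:ℝ) - k) ^ 2 * w k = h / 2 := by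
    have := congrArg (Polynomial.eval (1/2 : ℝ)) (bernsteinPolynomial.variance ℝ (2 * h))
    simp only [Polynomial.eval_finsetSum, bernsteinPolynomial] at this
    simp at this
    rw [show (h:ℝ) / 2 = 2 * h * 2⁻¹ * (1 - 2⁻¹) by ring, ← this]
    refine Finset.sum_congr rfl fun k _ => ?_
    simp [hw, bm]
    ring
  have wsymm : ∀ k ≤ 2 * h, w (2 * h - k) = w k := by
    intro k hk
    simp only [hw, bm]
    rw [Nat.choose_symm hk, Nat.sub_sub_self hk, show (1 - 1/2 : ℝ) = 1/2 by norm_num,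
      mul_comm ((1/2 : ℝ) ^ k)]
  -- far part
  have far : ∑ k ∈ Finset.range (2 * h + 1), w k * (if (s:ℝ) < |(h:ℝ) - k| then 1 else 0) ≤ 1 / 4 := by
    have hsp : (0:ℝ) < s := by exact_mod_cast hs
    have : ∑ k ∈ Finset.range (2 * h + 1), w k * (if (s:ℝ) < |(h:ℝ) - k| then 1 else 0) ≤
      ∑ k ∈ Finset.range (2 * h + 1), (1 / (s:ℝ)^2) * (((h:ℝ) - k) ^ 2 * w k) := by
      refine Finset.sum_le_sum fun k _ => ?_
      split_ifs with hk
      · rw [mul_one, ← mul_assoc, ← sq_abs ((h:ℝ) - k)]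
        have : 1 ≤ 1 / (s:ℝ)^2 * |(h:ℝ) - k|^2 := by
          rw [one_div, inv_mul_eq_div, one_le_div (by positivity)]
          gcongr
        nlinarith [w0 k]
      · have := w0 k
        rw [mul_zero]
        positivity
    rw [← Finset.mul_sum, wvar] at this
    refine this.trans ?_
    rw [one_div, inv_mul_eq_div, div_le_iff₀ (by positivity)]
    have : (2 * h : ℝ) ≤ s ^ 2 := by exact_mod_cast hs2
    linarith
  set near : ℕ → ℝ := fun k => w k * (if h ≤ k ∧ k ≤ h + s then 1 else 0) with hnear
  have n0 : ∀ k, 0 ≤ near k := fun k => mul_nonneg (w0 k) (by split_ifs <;> simp)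
  have tot : 1 ≤ ∑ k ∈ Finset.range (2 * h + 1), (w k * (if (s:ℝ) < |(h:ℝ) - k| then 1 else 0)
      + near k + near (2 * h - k)) := by
    refine le_trans wsum.ge ?_
    refine Finset.sum_le_sum fun k hk => ?_
    have hk' : k ≤ 2 * h := by simp at hk; omega
    have a1 := n0 k
    have a2 := n0 (2 * h - k)
    have a3 := w0 k
    by_cases hf : (s:ℝ) < |(h:ℝ) - k|
    · rw [if_pos hf]; linarith
    · simp only [hf, if_false]
      rw [not_lt, abs_le] at hf
      rcases le_or_gt h k with h3 | h3
      · have : k ≤ h + s := by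
          have : (k:ℝ) ≤ h + s := by linarith
          exact_mod_cast this
        have : near k = w k := by simp [hnear, h3, this]
        linarith
      · have : h ≤ k + s := by
          have : (h:ℝ) ≤ k + s := by linarith
          exact_mod_cast this
        have : near (2 * h - k) = w k := by
          simp only [hnear]
          rw [if_pos (by omega), wsymm k hk', mul_one]
        linarith
  have hrefl : ∑ k ∈ Finset.range (2 * h + 1), near (2 * h - k) = ∑ k ∈ Finset.range (2 * h + 1), near k := by
    have := Finset.sum_range_reflect near (2 * h + 1)
    simpa using this
  rw [Finset.sum_add_distrib, Finset.sum_add_distrib, hrefl] at tot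
  have nearsum : 3 / 8 ≤ ∑ k ∈ Finset.range (2 * h + 1), near k := by linarith
  calc _ ≤ (∑ k ∈ Finset.range (2 * h + 1), near k) * ((4 * p * (1 - p)) ^ h * (p / (1 - p)) ^ s) := by
        gcongr
    _ ≤ _ := by
      unfold Bt
      rw [Finset.sum_mul]
      refine Finset.sum_le_sum fun k hk => ?_
      have hk' : k ≤ 2 * h := by simp at hk; omega
      have hb := bm_nonneg h0.le (by linarith : p ≤ 1) (2*h) k
      by_cases hh : h ≤ k ∧ k ≤ h + s
      · obtain ⟨j, rfl⟩ : ∃ j, k = h + j := ⟨k - h, by omega⟩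
        obtain ⟨i, hi⟩ : ∃ i, h = j + i := ⟨h - j, by omega⟩
        have hj : j ≤ s := by omega
        simp only [hnear, hh, and_self, if_true, mul_one, hw, bm]
        rw [mul_assoc]
        refine mul_le_mul_of_nonneg_left ?_ (Nat.cast_nonneg _)
        have e1 : (p / (1 - p)) ^ s ≤ (p / (1 - p)) ^ j := by
          apply pow_le_pow_of_le_one (by positivity) _ hj
          rw [div_le_one hq]; linarith
        calc _ ≤ ((1/2:ℝ) ^ (h+j) * (1 - 1/2) ^ (2 * h - (h+j))) * ((4 * p * (1 - p)) ^ h * (p / (1 - p)) ^ j) := by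
              refine mul_le_mul_of_nonneg_left ?_ (by positivity)
              refine mul_le_mul_of_nonneg_left e1 (by positivity)
          _ = _ := by
            rw [show (1 - 1/2 : ℝ) = 1/2 by norm_num, ← pow_add, show h + j + (2*h - (h+j)) = 2 * h by omega,
              show 2 * h - (h+j) = i by omega, pow_mul, ← mul_assoc, ← mul_pow, div_pow p]
            rw [show ((1/2:ℝ)^2 * (4 * p * (1-p))) = p * (1-p) by ring, mul_pow, pow_add p]
            have : (1-p)^h = (1-p)^j * (1-p)^i := by rw [← pow_add, ← hi]
            rw [this]
            field_simp
      · simp only [hnear, hh, if_false, mul_zero, zero_mul]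
        split_ifs <;> simp [hb]



theorem exp_le_one_sub {x : ℝ} (h1 : x < 1) : Real.exp (-(x / (1 - x))) ≤ 1 - x := by
  have h := Real.add_one_le_exp (x / (1 - x))
  have hp : 0 < 1 - x := by linarith
  rw [Real.exp_neg]
  have e : x / (1 - x) + 1 = (1 - x)⁻¹ := by field_simp; ring
  rw [e] at h
  exact inv_le_of_inv_le₀ hp h

noncomputable def sg (d : ℕ) : ℝ := Real.sqrt (Real.log d / d)

theorem sg_tendsto : Tendsto sg atTop (nhds 0) := by
  have h1 := (Real.tendsto_pow_log_div_mul_add_atTop 1 0 1 one_ne_zero).comp (tendsto_natCast_atTop_atTop (R := ℝ))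
  have h2 : Tendsto (fun d : ℕ => Real.log d / d) atTop (nhds 0) := by
    refine h1.congr fun d => ?_
    simp
  have := (Real.continuous_sqrt.tendsto 0).comp h2
  rw [Real.sqrt_zero] at this
  exact this

theorem Bt_lower (c : ℝ) (hc0 : 0 < c) (hc : c < 1 / 2) (d b h s : ℕ) (hd : 1 < d) (β : ℝ)
    (hβ : 2 * c ^ 2 ≤ β * (1 - 4 * c ^ 2 * sg d ^ 2)) (hβ0 : 0 ≤ β) (hσ : sg d ≤ 1 / 4)
    (hh : 2 * h ≤ d) (hs : 0 < s) (hs1 : 2 * h ≤ s ^ 2) (hs2 : (s : ℝ) ≤ 2 * Real.sqrt d) :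
    (1 / 4) ^ b * (3 / 8) * Real.exp (-(β * Real.log d) - 8 * Real.sqrt (Real.log d)) ≤
      Bt (1 / 2 - c * sg d) (2 * h + b) (h + b) := by
  have hd' : (1:ℝ) < d := by exact_mod_cast hd
  have hd0 : (0:ℝ) < d := by linarith
  have ht : 0 < Real.log d := Real.log_pos hd'
  have hs0 : 0 ≤ sg d := Real.sqrt_nonneg _
  have hsq : sg d ^ 2 = Real.log d / d := Real.sq_sqrt (by positivity)
  have hmul : sg d * Real.sqrt d = Real.sqrt (Real.log d) := by
    unfold sg
    rw [← Real.sqrt_mul (by positivity), div_mul_cancel₀ _ hd0.ne']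
  set σ := sg d with hσd
  set p := 1 / 2 - c * σ with hp
  have hcσ : c * σ ≤ 1 / 8 := by nlinarith
  have hcσ0 : 0 ≤ c * σ := by positivity
  have p4 : 1 / 4 ≤ p := by linarith
  have p2 : p ≤ 1 / 2 := by linarith
  have B1 := Bt_half p (by linarith) p2 h s hs hs1
  have B2 := Bt_shift (by linarith : 0 ≤ p) (by linarith) (2 * h) h b
  refine le_trans ?_ B2
  rw [mul_assoc]
  have hq : 0 < 1 - p := by linarith
  refine mul_le_mul (by gcongr) (le_trans ?_ B1) (by positivity) (by positivity)
  refine mul_le_mul_of_nonneg_left ?_ (by norm_num)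
  rw [sub_eq_add_neg, Real.exp_add]
  refine mul_le_mul ?_ ?_ (by positivity) (by positivity)
  · have e : 4 * p * (1 - p) = 1 - 4 * c ^ 2 * σ ^ 2 := by rw [hp]; ring
    have xlt : 4 * c ^ 2 * σ ^ 2 < 1 := by nlinarith
    rw [e]
    refine le_trans ?_ (pow_le_pow_left₀ (Real.exp_pos _).le (exp_le_one_sub xlt) h)
    rw [← Real.exp_nat_mul]
    apply Real.exp_le_exp.2
    have hx : 0 < 1 - 4 * c ^ 2 * σ ^ 2 := by linarith
    rw [mul_neg, neg_le_neg_iff, ← mul_div_assoc, div_le_iff₀ hx]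
    have hh' : (h:ℝ) ≤ d / 2 := by
      have : (2 * h : ℝ) ≤ d := by exact_mod_cast hh
      linarith
    calc (h:ℝ) * (4 * c ^ 2 * σ ^ 2) ≤ d / 2 * (4 * c ^ 2 * σ ^ 2) := by gcongr
      _ = 2 * c ^ 2 * Real.log d := by rw [hsq]; field_simp; ring
      _ ≤ β * (1 - 4 * c ^ 2 * σ ^ 2) * Real.log d := by gcongr
      _ = _ := by ring
  · have e : p / (1 - p) = 1 - (4 * (c * σ)) / (1 + 2 * (c * σ)) := by
      have h1 : 1 - p = 1 / 2 * (1 + 2 * (c * σ)) := by rw [hp]; ring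
      have h2 : 1 + 2 * (c * σ) ≠ 0 := by positivity
      rw [h1, hp]; field_simp; ring
    set y := (4 * (c * σ)) / (1 + 2 * (c * σ)) with hy
    have y0 : 0 ≤ y := by positivity
    have y1 : y ≤ 2 * σ := by
      rw [hy, div_le_iff₀ (by positivity)]; nlinarith
    have y2 : y / (1 - y) ≤ 4 * σ := by
      rw [div_le_iff₀ (by linarith)]; nlinarith
    rw [e]
    refine le_trans ?_ (pow_le_pow_left₀ (Real.exp_pos _).le (exp_le_one_sub (by linarith)) s)
    rw [← Real.exp_nat_mul]
    apply Real.exp_le_exp.2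
    rw [mul_neg, neg_le_neg_iff]
    calc (s:ℝ) * (y / (1 - y)) ≤ (2 * Real.sqrt d) * (4 * σ) := by
          apply mul_le_mul hs2 y2 _ (by positivity)
          apply div_nonneg y0; linarith
      _ = _ := by rw [← hmul]; ring

theorem asym1 (c : ℝ) (hc0 : 0 < c) (hc : c < 1 / 2) (a b : ℕ) (L : ℝ) :
    ∀ᶠ d : ℕ in atTop, L * sg d ≤
      Bt (1 / 2 - c * sg d) (2 * ((d - a) / 2) + b) ((d - a) / 2 + b) := by
  obtain ⟨β, hβ1, hβ2⟩ : ∃ β : ℝ, 2 * c ^ 2 < β ∧ β < 1 / 2 := exists_between (by nlinarith)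
  have hβ0 : 0 < β := by nlinarith [sq_nonneg c]
  set C : ℝ := (1 / 4) ^ b * (3 / 8) with hC
  have hC0 : 0 < C := by positivity
  have ev1 : ∀ᶠ d in atTop, 2 * c ^ 2 ≤ β * (1 - 4 * c ^ 2 * sg d ^ 2) := by
    have : Tendsto (fun d => β * (1 - 4 * c ^ 2 * sg d ^ 2)) atTop
        (nhds (β * (1 - 4 * c ^ 2 * 0 ^ 2))) :=
      ((sg_tendsto.pow 2).const_mul _ |>.const_sub _).const_mul _
    exact (this.eventually (lt_mem_nhds (by simpa using hβ1))).mono fun _ h => h.le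
  have ev2 : ∀ᶠ d in atTop, sg d ≤ 1 / 4 :=
    (sg_tendsto.eventually (gt_mem_nhds (by norm_num : (0:ℝ) < 1/4))).mono fun _ h => h.le
  have tu : Tendsto (fun d : ℕ => Real.sqrt (Real.log d)) atTop atTop :=
    Real.tendsto_sqrt_atTop.comp (Real.tendsto_log_atTop.comp tendsto_natCast_atTop_atTop)
  filter_upwards [ev1, ev2, eventually_gt_atTop 1, tu.eventually_ge_atTop (9 / (1/2 - β)),
    tu.eventually_ge_atTop (2 * L / C), tu.eventually_ge_atTop 1] with d h1 h2 h3 h4 h5 h6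
  have hd' : (1:ℝ) < d := by exact_mod_cast h3
  have hd0 : (0:ℝ) < d := by linarith
  have ht : 0 < Real.log d := Real.log_pos hd'
  have hsd : 1 ≤ Real.sqrt d := by rw [Real.one_le_sqrt]; exact hd'.le
  refine le_trans ?_ (Bt_lower c hc0 hc d b ((d - a)/2) (⌈Real.sqrt d⌉₊) h3 β h1 hβ0.le h2 (by omega)
    (Nat.ceil_pos.2 (by positivity)) ?_ ?_)
  · set u := Real.sqrt (Real.log d) with hu
    have hu2 : u ^ 2 = Real.log d := Real.sq_sqrt ht.le
    have hmul : sg d * Real.sqrt d = u := by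
      unfold sg
      rw [← Real.sqrt_mul (by positivity), div_mul_cancel₀ _ hd0.ne']
    have hexp : Real.sqrt d = Real.exp (u ^ 2 / 2) := by
      rw [hu2, Real.sqrt_eq_rpow, Real.rpow_def_of_pos hd0]; ring_nf
    have hsg : sg d = u * Real.exp (-(u ^ 2 / 2)) := by
      rw [Real.exp_neg, ← hexp, ← hmul]; field_simp
    have hβ' : 0 < 1 / 2 - β := by linarith
    rw [div_le_iff₀ hβ'] at h4
    rw [div_le_iff₀ hC0] at h5
    rw [hsg, ← hu2]
    calc L * (u * Real.exp (-(u ^ 2 / 2))) ≤ (C * (u ^ 2 / 2)) * Real.exp (-(u ^ 2 / 2)) := by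
          rw [← mul_assoc]
          gcongr ?_ * _
          nlinarith
      _ ≤ C * Real.exp u * Real.exp (-(u ^ 2 / 2)) := by
          gcongr
          have := Real.quadratic_le_exp_of_nonneg (show 0 ≤ u by positivity)
          nlinarith
      _ = C * Real.exp (u - u ^ 2 / 2) := by rw [mul_assoc, ← Real.exp_add]; ring_nf
      _ ≤ _ := by
          refine mul_le_mul_of_nonneg_left (Real.exp_le_exp.2 ?_) hC0.le
          nlinarith
  · have : ((2 * ((d - a)/2) : ℕ) : ℝ) ≤ ((⌈Real.sqrt d⌉₊ ^ 2 : ℕ) : ℝ) := by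
      calc ((2 * ((d - a)/2) : ℕ) : ℝ) ≤ d := by
            exact_mod_cast (by omega : 2 * ((d - a)/2) ≤ d)
        _ = Real.sqrt d ^ 2 := (Real.sq_sqrt hd0.le).symm
        _ ≤ _ := by push_cast; gcongr; exact Nat.le_ceil _
    exact_mod_cast this
  · have := Nat.ceil_lt_add_one (Real.sqrt_nonneg d)
    linarith

theorem asym2 (c : ℝ) (hc0 : 0 < c) (a b : ℕ) (R : ℝ) :
    ∀ᶠ d : ℕ in atTop, R * bm (1 / 2 - c * sg d) (2 * ((d - a) / 2) + b) ((d - a) / 2 + b) ≤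
      Bt (1 / 2 - c * sg d) (2 * ((d - a) / 2) + (b + 1)) ((d - a) / 2 + (b + 1)) := by
  obtain ⟨M, hM⟩ := exists_nat_gt (8 * R)
  have th : Tendsto (fun d : ℕ => (d - a) / 2) atTop atTop := by
    refine tendsto_atTop.2 fun n => ?_
    filter_upwards [eventually_ge_atTop (2 * n + a)] with d hd
    omega
  have thr : Tendsto (fun d : ℕ => (((d - a) / 2 : ℕ) : ℝ)) atTop atTop :=
    tendsto_natCast_atTop_atTop.comp th
  have t1 : Tendsto (fun d : ℕ => ((((d - a) / 2 : ℕ) : ℝ) - M) / ((((d - a) / 2 : ℕ) : ℝ) + b + 1 + M))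
      atTop (nhds 1) := by
    have : Tendsto (fun d : ℕ => 1 - ((b : ℝ) + 1 + 2 * M) / ((((d - a) / 2 : ℕ) : ℝ) + (b + 1 + M)))
      atTop (nhds (1 - 0)) :=
      ((tendsto_atTop_add_const_right _ _ thr).const_div_atTop _).const_sub _
    rw [sub_zero] at this
    refine this.congr fun d => ?_
    have : (((d - a) / 2 : ℕ) : ℝ) + b + 1 + M ≠ 0 := by positivity
    have : (((d - a) / 2 : ℕ) : ℝ) + (b + 1 + M) ≠ 0 := by positivity
    field_simp
    ring
  have tp : Tendsto (fun d => 1 / 2 - c * sg d) atTop (nhds (1 / 2)) := by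
    have := (sg_tendsto.const_mul c).const_sub (1/2)
    simpa using this
  have t2 : Tendsto (fun d => (1 / 2 - c * sg d) / (1 - (1 / 2 - c * sg d))) atTop (nhds 1) := by
    have := tp.div (tp.const_sub 1) (by norm_num)
    norm_num at this
    refine this.congr fun d => ?_
    simp
  have t3 := (t1.mul t2).pow M
  rw [one_mul, one_pow] at t3
  filter_upwards [t3.eventually (lt_mem_nhds (by norm_num : (1/2:ℝ) < 1)),
    tp.eventually (lt_mem_nhds (by norm_num : (1/4:ℝ) < 1/2)), th.eventually_ge_atTop M] with d h1 h2 h3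
  have hs0 : 0 ≤ c * sg d := mul_nonneg hc0.le (Real.sqrt_nonneg _)
  refine le_trans ?_ (Bt_ge_ratio (by linarith) (by linarith) _ b M h3)
  have nn := bm_nonneg (by linarith : 0 ≤ 1 / 2 - c * sg d) (by linarith) (2 * ((d - a) / 2) + b) ((d - a) / 2 + b)
  refine mul_le_mul_of_nonneg_right ?_ nn
  have hM0 : (0:ℝ) ≤ M := Nat.cast_nonneg _
  calc R ≤ 1 / 4 * (M * (1 / 2)) := by linarith
    _ ≤ _ := by gcongr



noncomputable def gm {V : Type} [DecidableEq V] (T : ℕ) (U : Finset V) (A : Finset V) : ℝ :=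
  if T ≤ (A ∩ U).card then 0 else 1

theorem gm_dep {V : Type} [DecidableEq V] (T : ℕ) (U : Finset V) (A : Finset V) :
    gm T U A = gm T U (A ∩ U) := by
  unfold gm; rw [Finset.inter_assoc, Finset.inter_self]

theorem Ex_gm {V : Type} [DecidableEq V] (p : ℝ) (T : ℕ) (U : Finset V) :
    Ex p U (gm T U) = 1 - Bt p U.card T := by
  have h : Ex p U (fun A => gm T U A + if T ≤ A.card then 1 else 0) = 1 := by
    rw [← Ex_const p U 1]
    apply Ex_congr
    intro A hA
    unfold gm
    rw [Finset.inter_eq_left.2 hA, Ex_const]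
    split_ifs <;> simp
  rw [Ex_add, Ex_Bt] at h
  linarith

theorem Ex_gm_pair {V : Type} [DecidableEq V] (p : ℝ) (h0 : 0 ≤ p) (h1 : p ≤ 1) (n T : ℕ)
    (W W' : Finset V)
    (hW : W.card = n + 1) (hW' : W'.card = n + 1) (hi : (W ∩ W').card ≤ 1) :
    Ex p (W ∪ W') (fun A => gm (T+1) W A * gm (T+1) W' A) ≤
      (1 - Bt p (n + 1) (T + 1)) ^ 2 + bm p n T ^ 2 := by
  rcases Nat.le_one_iff_eq_zero_or_eq_one.1 hi with hi | hi
  · have hd : Disjoint W W' := Finset.disjoint_iff_inter_eq_empty.2 (Finset.card_eq_zero.1 hi)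
    rw [Ex_prod p W W' hd _ _ (gm_dep _ _) (gm_dep _ _), Ex_gm, Ex_gm, hW, hW']
    nlinarith [sq_nonneg (bm p n T)]
  · obtain ⟨u, hu⟩ := Finset.card_eq_one.1 hi
    have hu1 : u ∈ W ∩ W' := by rw [hu]; simp
    rw [Finset.mem_inter] at hu1
    obtain ⟨uW, uW'⟩ := hu1
    have hUc : (W.erase u).card = n := by rw [Finset.card_erase_of_mem uW, hW]; rfl
    have hUc' : (W'.erase u).card = n := by rw [Finset.card_erase_of_mem uW', hW']; rfl
    have huU : u ∉ W.erase u := by simp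
    have huU' : u ∉ W'.erase u := by simp
    have hWe : W = insert u (W.erase u) := (Finset.insert_erase uW).symm
    have hWe' : W' = insert u (W'.erase u) := (Finset.insert_erase uW').symm
    have hdis : Disjoint (W.erase u) (W'.erase u) := by
      rw [Finset.disjoint_left]
      intro v hv hv'
      have : v ∈ W ∩ W' := Finset.mem_inter.2 ⟨Finset.mem_of_mem_erase hv, Finset.mem_of_mem_erase hv'⟩
      rw [hu, Finset.mem_singleton] at this
      exact huU (this ▸ hv)
    generalize W.erase u = U at *
    generalize W'.erase u = U' at *
    subst hWe hWe'
    have e0 : insert u U ∪ insert u U' = insert u (U ∪ U') := by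
      ext v; simp
    have huu : u ∉ U ∪ U' := by simp [huU, huU']
    have g1 : ∀ (Z : Finset V) (A : Finset V), u ∉ Z → u ∉ A → gm (T+1) (insert u Z) A = gm (T+1) Z A := by
      intro Z A hZ hA
      unfold gm
      rw [Finset.inter_insert_of_notMem hA]
    have g2 : ∀ (Z : Finset V) (A : Finset V), u ∉ Z → u ∉ A →
        gm (T+1) (insert u Z) (insert u A) = gm T Z A := by
      intro Z A hZ hA
      unfold gm
      rw [← Finset.insert_inter_distrib, Finset.card_insert_of_notMem (by simp [hA])]
      simp
    rw [e0, Ex_insert p _ u huu]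
    have E1 : Ex p (U ∪ U') (fun A => gm (T+1) (insert u U) A * gm (T+1) (insert u U') A) =
        (1 - Bt p n (T+1)) ^ 2 := by
      rw [Ex_congr p _ _ (fun A => gm (T+1) U A * gm (T+1) U' A)
        (fun A hA => by rw [g1 U A huU (fun h => huu (hA h)), g1 U' A huU' (fun h => huu (hA h))])]
      rw [Ex_prod p _ _ hdis _ _ (gm_dep _ _) (gm_dep _ _), Ex_gm, Ex_gm, hUc, hUc']; ring
    have E2 : Ex p (U ∪ U') (fun A => gm (T+1) (insert u U) (insert u A) * gm (T+1) (insert u U') (insert u A)) =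
        (1 - Bt p n T) ^ 2 := by
      rw [Ex_congr p _ _ (fun A => gm T U A * gm T U' A)
        (fun A hA => by rw [g2 U A huU (fun h => huu (hA h)), g2 U' A huU' (fun h => huu (hA h))])]
      rw [Ex_prod p _ _ hdis _ _ (gm_dep _ _) (gm_dep _ _), Ex_gm, Ex_gm, hUc, hUc']; ring
    rw [E1, E2, Bt_succ, Bt_step p n T]
    have : p * (1 - p) ≤ 1 := by nlinarith
    nlinarith [mul_le_mul_of_nonneg_right this (sq_nonneg (bm p n T))]

noncomputable def FF {V : Type} [DecidableEq V] (T : ℕ) (W : V → Finset V) (y : V) (A : Finset V) : ℝ :=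
  gm 1 {y} A * gm T (W y) A

theorem gm_01 {V : Type} [DecidableEq V] (T : ℕ) (U : Finset V) (A : Finset V) :
    gm T U A = 0 ∨ gm T U A = 1 := by
  unfold gm; split_ifs <;> simp

theorem FF_01 {V : Type} [DecidableEq V] (T : ℕ) (W : V → Finset V) (y : V) (A : Finset V) :
    FF T W y A = 0 ∨ FF T W y A = 1 := by
  unfold FF
  rcases gm_01 1 {y} A with h | h <;> rcases gm_01 T (W y) A with h' | h' <;> simp [h, h']

theorem Bt_one_one (p : ℝ) : Bt p 1 1 = p := by
  simp [Bt, bm, Finset.sum_range_succ]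

theorem Ex_FF {V : Type} [DecidableEq V] (p : ℝ) (S : Finset V) (n T : ℕ) (W : V → Finset V)
    (y : V) (hy : y ∈ S) (hS : W y ⊆ S) (hyW : y ∉ W y) (hW : (W y).card = n) :
    Ex p S (FF T W y) = (1 - p) * (1 - Bt p n T) := by
  have := Ex_prod p {y} (W y) (by simpa using hyW) (gm 1 {y}) (gm T (W y)) (gm_dep _ _) (gm_dep _ _)
  rw [Ex_gm, Ex_gm, hW, Finset.card_singleton, Bt_one_one] at this
  rw [← this]
  apply Ex_restrict
  · intro v hv
    simp at hv
    rcases hv with rfl | hv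
    exacts [hy, hS hv]
  · intro A
    unfold FF
    simp only [gm]
    congr 4
    · grind
    · grind

theorem Ex_FF_pair {V : Type} [DecidableEq V] (p : ℝ) (h0 : 0 ≤ p) (h1 : p ≤ 1)
    (S I : Finset V) (n T : ℕ) (W : V → Finset V) (hI : I ⊆ S)
    (hS : ∀ y ∈ I, W y ⊆ S) (hdis : ∀ y ∈ I, Disjoint I (W y)) (hW : ∀ y ∈ I, (W y).card = n + 1)
    (hi : ∀ y ∈ I, ∀ z ∈ I, y ≠ z → (W y ∩ W z).card ≤ 1)
    (y z : V) (hy : y ∈ I) (hz : z ∈ I) (hyz : y ≠ z) :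
    Ex p S (fun A => FF (T+1) W y A * FF (T+1) W z A) ≤
      ((1 - p) * (1 - Bt p (n+1) (T+1))) ^ 2 + bm p n T ^ 2 := by
  have d1 : Disjoint ({y, z} : Finset V) (W y ∪ W z) := by
    rw [Finset.disjoint_union_right]
    have : ({y, z} : Finset V) ⊆ I := by
      intro v hv; simp at hv; rcases hv with rfl | rfl <;> assumption
    exact ⟨(hdis y hy).mono_left this, (hdis z hz).mono_left this⟩
  have e1 := Ex_prod p ({y, z}) (W y ∪ W z) d1 (fun A => gm 1 {y} A * gm 1 {z} A)
    (fun A => gm (T+1) (W y) A * gm (T+1) (W z) A)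
    (by intro A; simp only [gm]; congr 4 <;> grind)
    (by intro A; simp only [gm]; congr 4 <;> grind)
  have e2 := Ex_prod p {y} {z} (by simpa using hyz) (gm 1 {y}) (gm 1 {z}) (gm_dep _ _) (gm_dep _ _)
  rw [Ex_gm, Ex_gm, Finset.card_singleton, Finset.card_singleton, Bt_one_one] at e2
  have e3 : ({y} ∪ {z} : Finset V) = {y, z} := rfl
  rw [e3] at e2
  rw [e2] at e1
  have e4 : Ex p S (fun A => FF (T+1) W y A * FF (T+1) W z A) = Ex p ({y, z} ∪ (W y ∪ W z)) (fun A =>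
      gm 1 {y} A * gm 1 {z} A * (gm (T+1) (W y) A * gm (T+1) (W z) A)) := by
    rw [Ex_restrict p S ({y, z} ∪ (W y ∪ W z))]
    · apply Ex_congr; intro A _; unfold FF; ring
    · intro v hv
      have := hS y hy
      have := hS z hz
      have := hI hy
      have := hI hz
      grind
    · intro A
      unfold FF
      simp only [gm]
      congr 5 <;> grind
  rw [e4, e1]
  have e5 := Ex_gm_pair p h0 h1 n T (W y) (W z) (hW y hy) (hW z hz) (hi y hy z hz hyz)
  have : (1-p)^2 ≤ 1 := by nlinarith
  calc _ ≤ (1 - p) * (1 - p) * ((1 - Bt p (n + 1) (T + 1)) ^ 2 + bm p n T ^ 2) := by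
        apply mul_le_mul_of_nonneg_left e5
        nlinarith
    _ ≤ _ := by
      nlinarith [mul_le_mul_of_nonneg_right this (sq_nonneg (bm p n T))]

theorem cheb {V : Type} [DecidableEq V] (p : ℝ) (h0 : 0 ≤ p) (h1 : p ≤ 1)
    (S I : Finset V) (n T : ℕ) (W : V → Finset V) (hI : I ⊆ S)
    (hS : ∀ y ∈ I, W y ⊆ S) (hdis : ∀ y ∈ I, Disjoint I (W y)) (hW : ∀ y ∈ I, (W y).card = n + 1)
    (hi : ∀ y ∈ I, ∀ z ∈ I, y ≠ z → (W y ∩ W z).card ≤ 1) (φ : ℝ)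
    (hφ : φ = (1 - p) * (1 - Bt p (n+1) (T+1))) :
    Ex p S (fun A => (∑ y ∈ I, (FF (T+1) W y A - φ)) ^ 2) ≤ I.card + I.card ^ 2 * bm p n T ^ 2 := by
  have e1 : ∀ y ∈ I, Ex p S (FF (T+1) W y) = φ := fun y hy => by
    rw [hφ]
    exact Ex_FF p S (n+1) (T+1) W y (hI hy) (hS y hy) (Finset.disjoint_left.1 (hdis y hy) hy) (hW y hy)
  have hφ0 : 0 ≤ φ := by
    rw [hφ]; have := Bt_le_one h0 h1 (n+1) (T+1)
    apply mul_nonneg <;> linarith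
  have hφ1 : φ ≤ 1 := by
    rw [hφ]; have := Bt_le_one h0 h1 (n+1) (T+1); have := Bt_nonneg h0 h1 (n+1) (T+1)
    apply mul_le_one₀ <;> linarith
  have cov : ∀ y ∈ I, ∀ z ∈ I, Ex p S (fun A => (FF (T+1) W y A - φ) * (FF (T+1) W z A - φ)) ≤
      (if y = z then 1 else 0) + bm p n T ^ 2 := by
    intro y hy z hz
    have ex : Ex p S (fun A => (FF (T+1) W y A - φ) * (FF (T+1) W z A - φ)) =
        Ex p S (fun A => FF (T+1) W y A * FF (T+1) W z A) - φ ^ 2 := by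
      have : Ex p S (fun A => (FF (T+1) W y A - φ) * (FF (T+1) W z A - φ)) =
        Ex p S (fun A => (FF (T+1) W y A * FF (T+1) W z A + (-φ) * FF (T+1) W y A)
          + ((-φ) * FF (T+1) W z A + φ ^ 2)) := Ex_congr _ _ _ _ fun A _ => by ring
      rw [this, Ex_add, Ex_add, Ex_add, Ex_smul, Ex_smul, Ex_const, e1 y hy, e1 z hz]
      ring
    rw [ex]
    by_cases hyz : y = z
    · subst hyz
      rw [if_pos rfl]
      have : Ex p S (fun A => FF (T+1) W y A * FF (T+1) W y A) ≤ 1 := by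
        refine le_trans (Ex_mono p h0 h1 _ _ (fun _ => 1) fun A _ => ?_) (Ex_const p _ 1).le
        rcases FF_01 (T+1) W y A with h | h <;> rw [h] <;> norm_num
      nlinarith [sq_nonneg φ, sq_nonneg (bm p n T)]
    · rw [if_neg hyz]
      have := Ex_FF_pair p h0 h1 S I n T W hI hS hdis hW hi y z hy hz hyz
      rw [hφ]; linarith
  have e2 : Ex p S (fun A => (∑ y ∈ I, (FF (T+1) W y A - φ)) ^ 2) =
      ∑ y ∈ I, ∑ z ∈ I, Ex p S (fun A => (FF (T+1) W y A - φ) * (FF (T+1) W z A - φ)) := by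
    simp only [sq, Finset.sum_mul_sum]
    rw [Ex_sum]
    exact Finset.sum_congr rfl fun y _ => Ex_sum _ _ _ _
  rw [e2]
  refine le_trans (Finset.sum_le_sum fun y hy => Finset.sum_le_sum fun z hz => cov y hy z hz) ?_
  simp only [Finset.sum_add_distrib, Finset.sum_ite_eq, Finset.sum_const, nsmul_eq_mul]
  simp only [Finset.sum_ite_mem, Finset.inter_self, Finset.sum_const, nsmul_eq_mul]
  nlinarith

theorem prob_eq_Ex {V : Type} [Fintype V] [DecidableEq V] (p : ℝ) (E : Set V → Prop)
    [DecidablePred E] :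
    prob p E = Ex p Finset.univ (fun A : Finset V => if E (A : Set V) then 1 else 0) := by
  classical
  unfold prob Ex
  rw [finsum_mem_def, finsum_eq_sum_of_fintype, ← (Fintype.finsetEquivSet (α := V)).sum_comp]
  rw [Finset.powerset_univ]
  refine Finset.sum_congr rfl fun A _ => ?_
  simp only [Fintype.finsetEquivSet_apply, Set.indicator, Set.mem_setOf_eq, weight]
  rw [← Finset.coe_compl, Set.ncard_coe_finset, Set.ncard_coe_finset, Finset.card_compl, Finset.card_univ]
  split_ifs <;> simp



theorem props_of_InH {K : ℕ} {V : Type} {G : SimpleGraph V} (h : InH K G) (hc : Nat.card V ≠ 1) :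
    P1 K G ∧ P2 K G ∧ P3 K G := by
  obtain ⟨n, hn⟩ := h
  cases n with
  | zero => exact absurd hn hc
  | succ n =>
    rcases hn with hn | hn
    · exact absurd hn hc
    · exact ⟨hn.1, hn.2.1, hn.2.2.1⟩

/-- the local structure needed at a vertex -/
theorem local_structure {K : ℕ} {V : Type} [Fintype V] [DecidableEq V] {G : SimpleGraph V}
    (h1 : P1 K G) (h2 : P2 K G) (h3 : P3 K G) (x : V) (N : ℕ) (hN : N + 3 * K ≤ deg G x) :
    ∃ (I : Finset V) (W : V → Finset V), (∀ y ∈ I, G.Adj x y) ∧ I.card ≤ deg G x ∧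
      deg G x ≤ I.card + 1 ∧ (∀ y ∈ I, (W y : Set V) ⊆ G.neighborSet y) ∧
      (∀ y ∈ I, Disjoint I (W y)) ∧ (∀ y ∈ I, (W y).card = N) ∧
      (∀ y ∈ I, ∀ z ∈ I, y ≠ z → (W y ∩ W z).card ≤ 1) ∧
      (∀ y ∈ I, deg G y ≤ deg G x + K) := by
  classical
  obtain ⟨D, hxD, hD⟩ := h3 x
  have hs1 : ∀ y, y ∈ sphere G x 1 ↔ G.Adj x y := by
    intro y
    simp [sphere]
  have hD1 := hD 1 le_rfl
  simp only [Nat.sub_self, pow_zero, mul_one] at hD1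
  obtain ⟨a1, a2, a3, -⟩ := hD1
  have hdeg : ∀ y ∈ sphere G x 1, deg G y ≤ deg G x + K ∧ deg G x ≤ deg G y + K := by
    intro y hy
    have := h1 x 1 le_rfl y hy
    rw [abs_le] at this
    push_cast at this
    constructor <;> omega
  -- the sets
  set Wf : V → Set V := fun y => G.neighborSet y ∩ (sphere G x 2 \ D) with hWf
  have hWcard : ∀ y ∈ sphere G x 1 \ D, N ≤ (Wf y).ncard := by
    intro y hy
    have b1 := h2 x 1 le_rfl y hy.1
    have b2 := a2 y hy
    have b3 := (hdeg y hy.1).2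
    have cover : G.neighborSet y ⊆ Wf y ∪ (G.neighborSet y ∩ ball G x 1) ∪ (D ∩ G.neighborSet y) := by
      intro z hz
      by_cases hzD : z ∈ D
      · exact Or.inr ⟨hzD, hz⟩
      by_cases hzb : z ∈ ball G x 1
      · exact Or.inl (Or.inr ⟨hz, hzb⟩)
      · refine Or.inl (Or.inl ⟨hz, ?_, hzD⟩)
        have hle : G.edist x z ≤ 2 := by
          have t := G.edist_triangle (u := x) (v := y) (w := z)
          have e1 : G.edist x y = 1 := by simpa [sphere] using hy.1
          have e2 : G.edist y z = 1 := SimpleGraph.edist_eq_one_iff_adj.2 hz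
          rw [e1, e2] at t
          exact t.trans (by norm_num)
        have hgt : ¬ G.edist x z ≤ 1 := by simpa [ball] using hzb
        rw [not_le] at hgt
        have : (2 : ℕ∞) ≤ G.edist x z := by
          have := Order.add_one_le_of_lt hgt
          rwa [one_add_one_eq_two] at this
        exact le_antisymm hle this
    have c1 := Set.ncard_le_ncard cover (Set.toFinite _)
    have c2 := Set.ncard_union_le (Wf y ∪ (G.neighborSet y ∩ ball G x 1)) (D ∩ G.neighborSet y)
    have c3 := Set.ncard_union_le (Wf y) (G.neighborSet y ∩ ball G x 1)
    unfold deg at *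
    omega
  have hex : ∀ y, ∃ W : Finset V, y ∈ sphere G x 1 \ D → ((W : Set V) ⊆ Wf y ∧ W.card = N) := by
    intro y
    by_cases hy : y ∈ sphere G x 1 \ D
    · have := hWcard y hy
      rw [Set.ncard_eq_toFinset_card'] at this
      obtain ⟨W, hW1, hW2⟩ := Finset.exists_subset_card_eq this
      refine ⟨W, fun _ => ⟨fun v hv => ?_, hW2⟩⟩
      simpa using hW1 hv
    · exact ⟨∅, fun h => absurd h hy⟩
  choose W hW using hex
  have hmem : ∀ y, y ∈ (sphere G x 1 \ D).toFinset ↔ y ∈ sphere G x 1 \ D := fun y => Set.mem_toFinset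
  have hnb : sphere G x 1 = G.neighborSet x := by
    ext y; rw [hs1]; rfl
  have hIc : (sphere G x 1 \ D).toFinset.card = (sphere G x 1 \ D).ncard :=
    (Set.ncard_eq_toFinset_card' _).symm
  refine ⟨(sphere G x 1 \ D).toFinset, W, ?_, ?_, ?_, ?_, ?_, ?_, ?_, ?_⟩
  · intro y hy
    exact (hs1 y).1 ((hmem y).1 hy).1
  · rw [hIc]
    unfold deg
    rw [← hnb]
    exact Set.ncard_le_ncard Set.sdiff_subset (Set.toFinite _)
  · rw [hIc]
    unfold deg
    rw [← hnb]
    have := Set.ncard_inter_add_ncard_sdiff_eq_ncard (sphere G x 1) D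
    rw [Set.inter_comm] at this
    omega
  · intro y hy
    exact ((hW y ((hmem y).1 hy)).1).trans Set.inter_subset_left
  · intro y hy
    rw [Finset.disjoint_left]
    intro z hz hz'
    have e1 : z ∈ sphere G x 1 := ((hmem z).1 hz).1
    have e2 : z ∈ sphere G x 2 := ((hW y ((hmem y).1 hy)).1 hz').2.1
    simp only [sphere, Set.mem_ofPred_eq] at e1 e2
    rw [e1] at e2
    norm_num at e2
  · intro y hy
    exact (hW y ((hmem y).1 hy)).2
  · intro y hy z hz hyz
    refine le_trans ?_ (a3 y ((hmem y).1 hy) z ((hmem z).1 hz) hyz)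
    rw [← Set.ncard_coe_finset]
    apply Set.ncard_le_ncard _ (Set.toFinite _)
    intro v hv
    rw [Finset.coe_inter] at hv
    have e1 := (hW y ((hmem y).1 hy)).1 hv.1
    have e2 := (hW z ((hmem z).1 hz)).1 hv.2
    exact ⟨⟨e1.1, e2.1⟩, e1.2⟩
  · intro y hy
    exact (hdeg y ((hmem y).1 hy).1).1

theorem infected {V : Type} [Fintype V] [DecidableEq V] {G : SimpleGraph V} (m T : ℕ) (x : V)
    (I : Finset V) (W : V → Finset V) (hI : ∀ y ∈ I, G.Adj x y)
    (hWn : ∀ y ∈ I, (W y : Set V) ⊆ G.neighborSet y)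
    (hT : ∀ y ∈ I, (deg G y : ℝ) / 2 + m ≤ T) (A : Finset V)
    (hA : (deg G x : ℝ) / 2 + m ≤ ∑ y ∈ I, (1 - FF T W y A)) :
    x ∈ bootIterM G m (A : Set V) 2 := by
  classical
  right
  change (deg G x : ℝ) / 2 + m ≤ _
  refine hA.trans ?_
  set A1 := bootIterM G m (A : Set V) 1 with hA1
  have key : ∀ y ∈ I, FF T W y A = 0 → y ∈ A1 := by
    intro y hy h
    unfold FF at h
    rcases mul_eq_zero.1 h with h | h
    · left
      by_contra hn
      have hn' : y ∉ A := hn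
      simp [gm, hn'] at h
    · right
      change (deg G y : ℝ) / 2 + m ≤ ((G.neighborSet y ∩ (A : Set V)).ncard : ℝ)
      refine (hT y hy).trans ?_
      have hle : T ≤ (A ∩ W y).card := by
        by_contra hn
        simp [gm, hn] at h
      refine Nat.cast_le.2 (hle.trans ?_)
      rw [← Set.ncard_coe_finset]
      apply Set.ncard_le_ncard _ (Set.toFinite _)
      intro v hv
      rw [Finset.coe_inter] at hv
      exact ⟨hWn y hy hv.2, hv.1⟩
  have : ∑ y ∈ I, (1 - FF T W y A) ≤ ∑ y ∈ I, (if y ∈ A1 then (1:ℝ) else 0) := by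
    refine Finset.sum_le_sum fun y hy => ?_
    rcases FF_01 T W y A with h | h
    · simp [h, key y hy h]
    · rw [h]; split_ifs <;> simp
  refine this.trans ?_
  rw [← Finset.sum_filter, Finset.sum_const, nsmul_eq_mul, mul_one]
  refine Nat.cast_le.2 ?_
  rw [← Set.ncard_coe_finset]
  apply Set.ncard_le_ncard _ (Set.toFinite _)
  intro v hv
  simp at hv
  exact ⟨hI v hv.1, hv.2⟩

set_option maxHeartbeats 2000000

/-- Lemma: constant probability of infection after two rounds. -/
theorem statement4 (K m : ℕ) (c ε : ℝ) (hc0 : 0 < c) (hc : c < 1 / 2) (hε : 0 < ε) :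
    ∃ D₀ : ℕ, ∀ (V : Type) [Finite V], ∀ G : SimpleGraph V,
      InH K G → D₀ ≤ minDeg G → ∀ x : V,
      3 / 4 - ε ≤
        prob (1 / 2 - c * Real.sqrt (Real.log (deg G x) / (deg G x)))
          (fun A0 => x ∈ bootIterM G m A0 2) := by
  set b := 4 * K + 2 * m with hb
  set a := 3 * K + b + 1 with ha
  set L : ℝ := 4 * (2 + m) + 32 / ε with hL
  have hL0 : 0 < L := by positivity
  have hLm : 4 * (2 + (m:ℝ)) ≤ L := by rw [hL]; linarith [show 0 < 32 / ε by positivity]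
  have hLε : 32 ≤ ε * L ^ 2 := by
    have : 32 / ε ≤ L := by rw [hL]; linarith [show (0:ℝ) ≤ 4 * (2 + m) by positivity]
    rw [div_le_iff₀ hε] at this
    have : 1 ≤ L := by linarith [(Nat.cast_nonneg m : (0:ℝ) ≤ m)]
    nlinarith
  have ev := (asym1 c hc0 hc a (b+1) L).and ((asym2 c hc0 a b L).and
    ((sg_tendsto.eventually (gt_mem_nhds (by norm_num : (0:ℝ) < 1/4))).and (eventually_ge_atTop (a + 3))))
  obtain ⟨D₀, hD₀⟩ := eventually_atTop.1 ev
  refine ⟨D₀ + 1, fun V _ G hG hmin x => ?_⟩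
  classical
  have : Fintype V := Fintype.ofFinite V
  have hdx : D₀ + 1 ≤ deg G x := hmin.trans (Nat.sInf_le ⟨x, rfl⟩)
  have hcard : Nat.card V ≠ 1 := by
    intro h1
    have hs := (Nat.card_eq_one_iff_unique.1 h1).1
    have : G.neighborSet x = ∅ := by
      ext y
      simp [Subsingleton.elim y x]
    simp [deg] at hdx
  obtain ⟨p1, p2, p3⟩ := props_of_InH hG hcard
  obtain ⟨q1, q2, q3, q4⟩ := hD₀ (deg G x) (by omega)
  change 3 / 4 - ε ≤ prob (1 / 2 - c * sg (deg G x)) _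
  set d := deg G x with hd
  set σ := sg d with hσ
  set p := 1 / 2 - c * σ with hp
  set h := (d - a) / 2 with hh
  obtain ⟨I, W, i1, i2, i3, i4, i5, i6, i7, i8⟩ := local_structure p1 p2 p3 x (2 * h + (b + 1)) (by omega)
  rw [← hd] at i2 i3 i8
  have hσ0 : 0 ≤ σ := Real.sqrt_nonneg _
  have hd3 : (3:ℝ) ≤ d := by exact_mod_cast (by omega : 3 ≤ d)
  have hlog : 1 ≤ Real.log d := by
    rw [Real.le_log_iff_exp_le (by linarith)]
    exact (Real.exp_one_lt_d9.le.trans (by norm_num)).trans hd3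
  have hdσ2 : 1 ≤ d * σ ^ 2 := by
    have : σ ^ 2 = Real.log d / d := Real.sq_sqrt (by positivity)
    rw [this, mul_div_cancel₀ _ (by positivity)]
    exact hlog
  have hdσ : 1 ≤ d * σ := by nlinarith
  have hcσ : c * σ ≤ 1 / 2 * σ := by gcongr
  have hcσ0 : 0 ≤ c * σ := by positivity
  have hp0 : 1 / 4 ≤ p := by linarith
  have hp1 : p ≤ 1 / 2 := by linarith
  set q := Bt p (2 * h + (b + 1)) (h + (b + 1)) with hq
  set r := bm p (2 * h + b) (h + b) with hr
  have hr0 : 0 ≤ r := bm_nonneg (by linarith) (by linarith) _ _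
  have hqn : 0 ≤ q := Bt_nonneg (by linarith) (by linarith) _ _
  have hq1 : q ≤ 1 := Bt_le_one (by linarith) (by linarith) _ _
  have ch := cheb p (by linarith) (by linarith) Finset.univ I (2 * h + b) (h + b) W (Finset.subset_univ _)
    (fun y _ => Finset.subset_univ _) i5 i6 i7 _ rfl
  set φ := (1 - p) * (1 - Bt p (2 * h + b + 1) (h + b + 1)) with hφ
  have hφq : φ = (1 - p) * (1 - q) := rfl
  rw [← hr] at ch
  set N : ℝ := (I.card : ℝ) with hN
  have hN1 : N ≤ d := by rw [hN]; exact_mod_cast i2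
  have hN2 : (d:ℝ) ≤ N + 1 := by rw [hN]; exact_mod_cast i3
  set l := N * (1 - φ) - (d / 2 + m) with hl
  have hφ1 : 1 - φ ≤ 1 := by
    rw [hφq]; have : 0 ≤ (1 - p) * (1 - q) := by apply mul_nonneg <;> linarith
    linarith
  have hφ2 : p + q / 2 ≤ 1 - φ := by 
    have : p * q ≤ 1 / 2 * q := mul_le_mul_of_nonneg_right hp1 hqn
    rw [hφq]; linarith
  have hl1 : d * q / 4 ≤ l := by
    have s1 : d * (1 - φ) - 1 ≤ N * (1 - φ) := by
      have k0 : 0 ≤ 1 - φ := by linarith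
      have k1 := mul_le_mul_of_nonneg_right hN2 k0
      linarith
    have s2 : d * (p + q / 2) ≤ d * (1 - φ) := by gcongr
    have s3 : c * (d * σ) + 1 + m ≤ (2 + m) * (d * σ) := by
      have k1 := mul_le_mul_of_nonneg_left hdσ (Nat.cast_nonneg m : (0:ℝ) ≤ m)
      have k2 := mul_le_mul_of_nonneg_right (by linarith : c ≤ 1) (by linarith : 0 ≤ d * σ)
      linarith
    have s4 : (2 + m) * (d * σ) ≤ d * q / 4 := by
      have : 4 * (2 + (m:ℝ)) * σ ≤ q := le_trans (by gcongr) q1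
      have := mul_le_mul_of_nonneg_left this (by linarith : (0:ℝ) ≤ d)
      linarith
    rw [hl]
    have : d * p = d / 2 - c * (d * σ) := by rw [hp]; ring
    linarith
  have hσpos : 0 < σ := by
    rcases hσ0.eq_or_lt with h | h
    · rw [← h] at hdσ; norm_num at hdσ
    · exact h
  have hqpos : 0 < q := lt_of_lt_of_le (by positivity) q1
  have hlpos : 0 < l := lt_of_lt_of_le (by positivity) hl1
  have hfin : N + N ^ 2 * r ^ 2 ≤ ε * l ^ 2 := by
    have hN0 : 0 ≤ N := Nat.cast_nonneg _
    have t1 : L ^ 2 ≤ d * q ^ 2 := by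
      calc L ^ 2 ≤ L ^ 2 * (d * σ ^ 2) := le_mul_of_one_le_right (sq_nonneg L) hdσ2
        _ = d * (L * σ) ^ 2 := by ring
        _ ≤ _ := by gcongr
    have t2 : L ^ 2 * r ^ 2 ≤ q ^ 2 := by rw [← mul_pow]; gcongr
    have t3 : L ^ 2 * (N + N ^ 2 * r ^ 2) ≤ 2 * (d * q) ^ 2 := by
      have u1 : L ^ 2 * N ≤ (d * q ^ 2) * d := by gcongr
      have u2 : N ^ 2 * (L ^ 2 * r ^ 2) ≤ (d:ℝ) ^ 2 * q ^ 2 := by gcongr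
      linarith
    have t4 : (d * q / 4) ^ 2 ≤ l ^ 2 := by gcongr
    have t5 : L ^ 2 * (N + N ^ 2 * r ^ 2) ≤ L ^ 2 * (ε * l ^ 2) := by
      calc _ ≤ 2 * (d * q) ^ 2 := t3
        _ = 32 * (d * q / 4) ^ 2 := by ring
        _ ≤ (ε * L ^ 2) * l ^ 2 := by gcongr
        _ = _ := by ring
    exact le_of_mul_le_mul_left t5 (by positivity)
  rw [prob_eq_Ex]
  have lower : Ex p Finset.univ (fun A : Finset V => 1 + (-(1 / l ^ 2)) *
      (∑ y ∈ I, (FF (h + b + 1) W y A - φ)) ^ 2) ≤ Ex p Finset.univ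
      (fun A : Finset V => if x ∈ bootIterM G m (A : Set V) 2 then 1 else 0) := by
    refine Ex_mono p (by linarith) (by linarith) _ _ _ fun A _ => ?_
    have hpos : 0 ≤ 1 / l ^ 2 * (∑ y ∈ I, (FF (h + b + 1) W y A - φ)) ^ 2 := by positivity
    split_ifs with hx
    · linarith
    · have hlt : ∑ y ∈ I, (1 - FF (h + b + 1) W y A) < (d:ℝ) / 2 + m := by
        by_contra hn
        rw [not_lt] at hn
        refine hx (infected m (h + b + 1) x I W i1 i4 (fun y hy => ?_) A hn)
        have := i8 y hy
        have : deg G y + 2 * m ≤ 2 * (h + b + 1) := by omega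
        have : ((deg G y : ℝ)) + 2 * m ≤ 2 * ((h + b + 1 : ℕ) : ℝ) := by exact_mod_cast this
        linarith
      have e1 : ∑ y ∈ I, (FF (h + b + 1) W y A - φ) = N * (1 - φ) - ∑ y ∈ I, (1 - FF (h + b + 1) W y A) := by
        simp only [Finset.sum_sub_distrib, Finset.sum_const, nsmul_eq_mul]
        ring
      have e2 : l ≤ ∑ y ∈ I, (FF (h + b + 1) W y A - φ) := by rw [e1]; linarith
      have e3 : 1 ≤ 1 / l ^ 2 * (∑ y ∈ I, (FF (h + b + 1) W y A - φ)) ^ 2 := by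
        rw [one_div, inv_mul_eq_div, one_le_div (by positivity)]
        gcongr
      linarith
  refine le_trans ?_ lower
  rw [Ex_add, Ex_const, Ex_smul]
  have : 1 / l ^ 2 * Ex p Finset.univ (fun A => (∑ y ∈ I, (FF (h + b + 1) W y A - φ)) ^ 2) ≤ ε := by
    rw [one_div, inv_mul_eq_div, div_le_iff₀ (by positivity)]
    exact ch.trans hfin
  linarith

end MBP
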